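/- arXiv:2603.19772 — 2 statements merged into one kernel-verified Lean document; each statement's English description precedes it below -/
import Mathlib

section
/- If every sequence in a subset K of 𝔓_r has bounded mean complexity, then the set {𝟙_A : A ∈ α ∈ K} is precompact in L²(μ); consequently K is precompact in the Rokhlin metric. -/
open MeasureTheory Filter Real Topology
open scoped symmDiff ENNReal

variable {X : Type*} [MeasurableSpace X]

/-- A finite measurable partition of `X` (mod `μ`-null sets), with atoms indexed by `ι`. -/
def IsPartition (μ : Measure X) {ι : Type*} (A : ι → Set X) : Prop :=
  (∀ i, MeasurableSet (A i)) ∧ Pairwise (Function.onFun Disjoint A) ∧ μ (⋃ i, A i)ᶜ = 0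

/-- `μ(A|B)`, with the convention that it is `0` when `μ B = 0`. -/
noncomputable def condProb (μ : Measure X) (A B : Set X) : ℝ :=
  if μ B = 0 then 0 else (μ (A ∩ B)).toReal / (μ B).toReal

/-- Conditional entropy `H_μ(α|β)` of two finite partitions. -/
noncomputable def condEntropy' (μ : Measure X) {ι κ : Type*} [Fintype ι] [Fintype κ]
    (A : ι → Set X) (B : κ → Set X) : ℝ :=
  ∑ j, (μ (B j)).toReal * ∑ i, Real.negMulLog (condProb μ (A i) (B j))

/-- The Rokhlin distance `ρ(α,β) = H_μ(α|β) + H_μ(β|α)`. -/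
noncomputable def rokhlinDist (μ : Measure X) {ι κ : Type*} [Fintype ι] [Fintype κ]
    (A : ι → Set X) (B : κ → Set X) : ℝ :=
  condEntropy' μ A B + condEntropy' μ B A

/-- Shannon entropy `H_μ(α)` of a finite partition. -/
noncomputable def partEntropy (μ : Measure X) {ι : Type*} [Fintype ι] (A : ι → Set X) : ℝ :=
  ∑ i, Real.negMulLog (μ (A i)).toReal

/-- Entropy of the join `⋁_{i=1}^n α_i` of `n` finite partitions. -/
noncomputable def jointEntropy (μ : Measure X) {n : ℕ} {ι : Type*} [Fintype ι]
    (A : Fin n → ι → Set X) : ℝ :=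
  ∑ f : Fin n → ι, Real.negMulLog (μ (⋂ i, A i (f i))).toReal

/-- `ρ̃(α,β)`: the minimal total symmetric difference over matchings of atoms. -/
noncomputable def rhoTilde (μ : Measure X) {r : ℕ} (A B : Fin r → Set X) : ℝ :=
  ⨅ σ : Equiv.Perm (Fin r), ∑ i, (μ (A i ∆ B (σ i))).toReal

/-- Total boundedness (precompactness) of a set w.r.t. a distance-like function. -/
def TotBddIn {α : Type*} (d : α → α → ℝ) (K : Set α) : Prop :=
  ∀ ε > 0, ∃ F : Finset α, ↑F ⊆ K ∧ ∀ a ∈ K, ∃ b ∈ F, d a b < ε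

open Classical in
/-- Normalized Hamming distance w.r.t. a finite family `E` of partitions. -/
noncomputable def hamDist {r : ℕ} (E : Finset (Fin r → Set X)) (x y : X) : ℝ :=
  ((E.filter fun α => ∀ i, ¬(x ∈ α i ∧ y ∈ α i)).card : ℝ) / E.card

/-- Ball for the normalized Hamming distance. -/
def hamBall {r : ℕ} (E : Finset (Fin r → Set X)) (x : X) (ε : ℝ) : Set X :=
  {y | hamDist E x y < ε}



open Classical in
lemma pc_hamDist {r : ℕ} [DecidableEq (Fin r → Set X)] (A : ℕ → Fin r → Set X)
    (hinj : Function.Injective A) (n : ℕ) (x y : X) :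
    hamDist ((Finset.range n).image A) x y =
      (((Finset.range n).filter fun k => ∀ i, ¬(x ∈ A k i ∧ y ∈ A k i)).card : ℝ) / n := by
  unfold hamDist
  rw [Finset.card_image_of_injective _ hinj, Finset.card_range, Finset.filter_image,
    Finset.card_image_of_injective _ hinj]

lemma pc_key (μ : Measure X) [IsProbabilityMeasure μ] {r : ℕ} [DecidableEq (Fin r → Set X)]
    (A : ℕ → Fin r → Set X) (hA : ∀ n, IsPartition μ (A n)) (hinj : Function.Injective A)
    (ε : ℝ) (hε : 0 < ε) (C : ℕ)
    (hC : ∀ n : ℕ, ∃ D : Finset X, D.card ≤ C ∧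
          μ (⋃ x ∈ D, hamBall ((Finset.range n).image A) x ε) > 1 - ENNReal.ofReal ε) :
    ∃ k l, k < l ∧ ∀ i, μ.real (A k i ∆ A l i) ≤ 9 * ε := by
  classical
  set n : ℕ := 2 * 2 ^ (C * r) + 2 with hn
  have hn0 : (0 : ℝ) < n := by positivity
  obtain ⟨D, hDC, hD⟩ := hC n
  set U : Set X := ⋃ x ∈ D, hamBall ((Finset.range n).image A) x ε with hU
  let φ : X → (Fin n × Fin r → Prop) := fun y p => y ∈ A p.1 p.2
  have hφ : Measurable φ := by
    rw [measurable_pi_iff]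
    intro p
    exact measurableSet_setOfPred.1 ((hA p.1).1 p.2)
  have hmeas : ∀ S : Set X, (∀ y y', φ y = φ y' → y ∈ S → y' ∈ S) → MeasurableSet S := by
    intro S hS
    have : S = φ ⁻¹' (φ '' S) := by
      ext y
      constructor
      · exact fun h => ⟨y, h, rfl⟩
      · rintro ⟨z, hz, hzy⟩
        exact hS z y hzy hz
    rw [this]
    exact hφ (Set.toFinite _).measurableSet
  have hmem : ∀ y y', φ y = φ y' → ∀ k < n, ∀ i, (y ∈ A k i ↔ y' ∈ A k i) := by
    intro y y' h k hk i
    exact iff_of_eq (congrFun h (⟨k, hk⟩, i))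
  have hball : ∀ x y, y ∈ hamBall ((Finset.range n).image A) x ε ↔
      (((Finset.range n).filter fun k => ∀ i, ¬(x ∈ A k i ∧ y ∈ A k i)).card : ℝ) < ε * n := by
    intro x y
    unfold hamBall
    rw [Set.mem_ofPred_eq, pc_hamDist A hinj, div_lt_iff₀ hn0]
  have hball' : ∀ x y y', φ y = φ y' → y ∈ hamBall ((Finset.range n).image A) x ε →
      y' ∈ hamBall ((Finset.range n).image A) x ε := by
    intro x y y' h hy
    rw [hball] at hy ⊢
    convert hy using 3
    apply Finset.filter_congr
    intro k hk
    simp only [hmem y y' h k (Finset.mem_range.1 hk)]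
  have hUm : MeasurableSet U := by
    apply hmeas
    intro y y' h hy
    simp only [hU, Set.mem_iUnion] at hy ⊢
    obtain ⟨x, hx, hxy⟩ := hy
    exact ⟨x, hx, hball' x y y' h hxy⟩
  have hne : Nonempty X := μ.nonempty_of_neZero
  have hc : ∀ v, ∃ x, ∀ y, φ y = v → y ∈ U →
      x ∈ D ∧ y ∈ hamBall ((Finset.range n).image A) x ε := by
    intro v
    by_cases h : ∃ y ∈ U, φ y = v
    · obtain ⟨y, hy, rfl⟩ := h
      simp only [hU, Set.mem_iUnion] at hy
      obtain ⟨x, hx, hxy⟩ := hy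
      exact ⟨x, fun y' h' _ => ⟨hx, hball' x y y' h'.symm hxy⟩⟩
    · exact ⟨hne.some, fun y hy hyU => (h ⟨y, hyU, hy⟩).elim⟩
  choose c hc using hc
  let B : ℕ → Set X := fun k => {y | ∀ i, ¬(c (φ y) ∈ A k i ∧ y ∈ A k i)}
  have hBm : ∀ k < n, MeasurableSet (B k) := by
    intro k hk
    apply hmeas
    intro y y' h hy i
    rw [← h, ← hmem y y' h k hk]
    exact hy i
  have hUc : μ.real Uᶜ ≤ ε := by
    rw [Measure.real, prob_compl_eq_one_sub hUm]
    apply ENNReal.toReal_le_of_le_ofReal hε.le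
    rw [tsub_le_iff_right]
    have := hD.le
    rw [tsub_le_iff_right] at this
    rwa [add_comm]
  have hsum : ∑ k ∈ Finset.range n, μ.real (B k) ≤ 2 * ε * n := by
    have h1 : ∑ k ∈ Finset.range n, μ.real (B k) =
        ∫ y, ∑ k ∈ Finset.range n, (B k).indicator (fun _ => (1 : ℝ)) y ∂μ := by
      rw [integral_finsetSum]
      · apply Finset.sum_congr rfl
        intro k hk
        rw [integral_indicator_const _ (hBm k (Finset.mem_range.1 hk))]
        simp
      · intro k hk
        exact (integrable_const _).indicator (hBm k (Finset.mem_range.1 hk))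
    have h2 : ∫ y, (ε * n + Uᶜ.indicator (fun _ => (n : ℝ)) y) ∂μ = ε * n + μ.real Uᶜ * n := by
      rw [integral_add (integrable_const _) ((integrable_const _).indicator hUm.compl),
        integral_indicator_const _ hUm.compl]
      simp
    have h3 : ∫ y, ∑ k ∈ Finset.range n, (B k).indicator (fun _ => (1 : ℝ)) y ∂μ ≤
        ∫ y, (ε * n + Uᶜ.indicator (fun _ => (n : ℝ)) y) ∂μ := by
      apply integral_mono
      · apply integrable_finsetSum
        intro k hk
        exact (integrable_const _).indicator (hBm k (Finset.mem_range.1 hk))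
      · exact (integrable_const _).add ((integrable_const _).indicator hUm.compl)
      · intro y
        have h4 : ∑ k ∈ Finset.range n, (B k).indicator (fun _ => (1 : ℝ)) y =
            (((Finset.range n).filter fun k =>
              ∀ i, ¬(c (φ y) ∈ A k i ∧ y ∈ A k i)).card : ℝ) := by
          rw [Finset.card_filter]
          push_cast
          apply Finset.sum_congr rfl
          intro k _
          simp only [Set.indicator_apply, B, Set.mem_ofPred_eq]
        show ∑ k ∈ Finset.range n, (B k).indicator (fun _ => (1 : ℝ)) y ≤
          ε * n + Uᶜ.indicator (fun _ => (n : ℝ)) y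
        rw [h4]
        by_cases hy : y ∈ U
        · have := (hball _ _).1 (hc (φ y) y rfl hy).2
          rw [Set.indicator_of_notMem (by simpa using hy)]
          linarith
        · rw [Set.indicator_of_mem (by simpa using hy)]
          have h5 : (((Finset.range n).filter fun k =>
              ∀ i, ¬(c (φ y) ∈ A k i ∧ y ∈ A k i)).card : ℝ) ≤ n := by
            exact_mod_cast (Finset.card_filter_le _ _).trans (Finset.card_range n).le
          have : 0 ≤ ε * n := by positivity
          linarith
    rw [h1]
    refine h3.trans ?_
    rw [h2]
    nlinarith
  let G := (Finset.range n).filter fun k => μ.real (B k) ≤ 4 * ε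
  let G' := (Finset.range n).filter fun k => ¬ μ.real (B k) ≤ 4 * ε
  have hGG : G.card + G'.card = n := by
    rw [Finset.card_filter_add_card_filter_not, Finset.card_range]
  have hG' : (G'.card : ℝ) * (4 * ε) ≤ 2 * ε * n := by
    refine le_trans ?_ hsum
    calc (G'.card : ℝ) * (4 * ε) = ∑ k ∈ G', 4 * ε := by simp
      _ ≤ ∑ k ∈ G', μ.real (B k) :=
        Finset.sum_le_sum fun k hk => (not_le.1 (Finset.mem_filter.1 hk).2).le
      _ ≤ _ := Finset.sum_le_sum_of_subset_of_nonneg (Finset.filter_subset _ _)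
        fun _ _ _ => measureReal_nonneg
  have hG'2 : 2 * G'.card ≤ n := by
    have : (2 : ℝ) * G'.card ≤ n := by
      by_contra h
      push Not at h
      nlinarith
    exact_mod_cast this
  have hcard : ((D ×ˢ (Finset.univ : Finset (Fin r))).powerset).card < G.card := by
    rw [Finset.card_powerset, Finset.card_product, Finset.card_univ, Fintype.card_fin]
    have : 2 ^ (D.card * r) ≤ 2 ^ (C * r) :=
      Nat.pow_le_pow_right (by norm_num) (Nat.mul_le_mul_right _ hDC)
    omega
  obtain ⟨k, hk, l, hl, hkl, hpat⟩ := Finset.exists_ne_map_eq_of_card_lt_of_maps_to hcard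
    (f := fun k => (D ×ˢ (Finset.univ : Finset (Fin r))).filter fun p => p.1 ∈ A k p.2)
    (fun k _ => Finset.mem_coe.2 (Finset.mem_powerset.2 (Finset.filter_subset _ _)))
  have hp : ∀ x ∈ D, ∀ i, (x ∈ A k i ↔ x ∈ A l i) := by
    intro x hx i
    have := Finset.ext_iff.1 hpat (x, i)
    simpa [hx] using this
  have hsub : ∀ i, A k i ∆ A l i ⊆ B k ∪ B l ∪ Uᶜ := by
    intro i y hy
    by_contra hcon
    simp only [Set.mem_union, Set.mem_compl_iff, not_or, not_not] at hcon
    obtain ⟨⟨hyk, hyl⟩, hyU⟩ := hcon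
    simp only [B, Set.mem_ofPred_eq, not_forall, not_not] at hyk hyl
    obtain ⟨i0, h1, h2⟩ := hyk
    obtain ⟨j0, h3, h4⟩ := hyl
    have hcD := (hc (φ y) y rfl hyU).1
    have huniq : ∀ m z a b, z ∈ A m a → z ∈ A m b → a = b := by
      intro m z a b ha hb
      by_contra hab
      exact Set.disjoint_left.1 ((hA m).2.1 hab) ha hb
    have e1 : i0 = j0 := huniq l _ _ _ ((hp _ hcD _).1 h1) h3
    subst e1
    rcases hy with ⟨h5, h6⟩ | ⟨h5, h6⟩
    · exact h6 (huniq k y _ _ h2 h5 ▸ h4)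
    · exact h6 (huniq l y _ _ h4 h5 ▸ h2)
  have hle : ∀ i, μ.real (A k i ∆ A l i) ≤ 9 * ε := by
    intro i
    have h1 := measureReal_mono (μ := μ) (hsub i)
    have h2 := measureReal_union_le (μ := μ) (B k ∪ B l) Uᶜ
    have h3 := measureReal_union_le (μ := μ) (B k) (B l)
    have h4 := (Finset.mem_filter.1 hk).2
    have h5 := (Finset.mem_filter.1 hl).2
    linarith
  rcases lt_or_gt_of_ne hkl with h | h
  · exact ⟨k, l, h, hle⟩
  · refine ⟨l, k, h, fun i => ?_⟩
    rw [symmDiff_comm]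
    exact hle i

lemma pc_totBdd (μ : Measure X) [IsProbabilityMeasure μ]
    {r : ℕ} [DecidableEq (Fin r → Set X)]
    (K : Set (Fin r → Set X)) (hK : ∀ α ∈ K, IsPartition μ α)
    (hbd : ∀ A : ℕ → Fin r → Set X, (∀ n, A n ∈ K) →
      ∀ ε > (0 : ℝ), ∃ C : ℕ, ∀ n : ℕ,
        ∃ D : Finset X, D.card ≤ C ∧
          μ (⋃ x ∈ D, hamBall ((Finset.range n).image A) x ε) > 1 - ENNReal.ofReal ε)
    (δ : ℝ) (hδ : 0 < δ) :
    ∃ F : Finset (Fin r → Set X), ↑F ⊆ K ∧ ∀ a ∈ K, ∃ b ∈ F, ∀ i, μ.real (a i ∆ b i) < δ := by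
  by_contra hcon
  push Not at hcon
  obtain ⟨A, hAK, hA⟩ := exists_seq_of_forall_finset_exists (fun a => a ∈ K)
    (fun b a => ∃ i, δ ≤ μ.real (a i ∆ b i)) (fun s hs => hcon s (fun x hx => hs x hx))
  have hne : ∀ m n, m < n → A m ≠ A n := by
    intro m n h e
    obtain ⟨i, hi⟩ := hA m n h
    rw [e] at hi
    simp at hi
    linarith
  have hinj : Function.Injective A := by
    intro m n e
    by_contra h
    rcases lt_or_gt_of_ne h with h | h
    · exact hne _ _ h e
    · exact hne _ _ h e.symm
  obtain ⟨C, hC⟩ := hbd A hAK (δ / 10) (by positivity)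
  obtain ⟨k, l, hkl, h⟩ := pc_key μ A (fun n => hK _ (hAK n)) hinj (δ / 10) (by positivity) C hC
  obtain ⟨i, hi⟩ := hA k l hkl
  have := h i
  rw [symmDiff_comm] at this
  linarith

lemma pc_term (p b : ℝ) (hp : 0 ≤ p) (hpb : p ≤ b) (hb : 0 < b) (hb1 : b ≤ 1) :
    b * Real.negMulLog (p / b) ≤ Real.negMulLog p ∧ b * Real.negMulLog (p / b) ≤ b - p := by
  rcases hp.eq_or_lt with h | h
  · subst h
    simp
    exact hb.le
  · have e : b * Real.negMulLog (p / b) = p * (Real.log b - Real.log p) := by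
      rw [Real.negMulLog, Real.log_div h.ne' hb.ne']
      field_simp
      ring
    rw [e]
    constructor
    · have := Real.log_nonpos hb.le hb1
      rw [Real.negMulLog]
      nlinarith
    · rw [← Real.log_div hb.ne' h.ne']
      have h1 := Real.log_le_sub_one_of_pos (div_pos hb h)
      have h2 : p * Real.log (b / p) ≤ p * (b / p - 1) := mul_le_mul_of_nonneg_left h1 hp
      have h3 : p * (b / p - 1) = b - p := by field_simp
      linarith

lemma pc_entropy (μ : Measure X) [IsProbabilityMeasure μ] {r : ℕ} (A B : Fin r → Set X)
    (hA : IsPartition μ A) (hB : IsPartition μ B) (δ η : ℝ) (hδη : δ ≤ η)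
    (hη : ∀ p, 0 ≤ p → p < δ → Real.negMulLog p ≤ η) (hδ : 0 < δ)
    (h : ∀ i, μ.real (A i ∆ B i) < δ) : condEntropy' μ A B ≤ r * (r * η) := by
  have key : ∀ j i, μ.real (B j) * Real.negMulLog (condProb μ (A i) (B j)) ≤ η := by
    intro j i
    unfold condProb
    split_ifs with h0
    · simp
      linarith
    · have hb : 0 < μ.real (B j) := ENNReal.toReal_pos h0 (measure_ne_top _ _)
      have ht := pc_term (μ.real (A i ∩ B j)) (μ.real (B j)) measureReal_nonneg
        (measureReal_mono Set.inter_subset_right) hb measureReal_le_one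
      change μ.real (B j) * Real.negMulLog (μ.real (A i ∩ B j) / μ.real (B j)) ≤ η
      by_cases hij : i = j
      · subst hij
        refine ht.2.trans ?_
        have h1 := measureReal_inter_add_sdiff (μ := μ) (s := B i) (hA.1 i)
        have h2 : μ.real (B i \ A i) ≤ μ.real (A i ∆ B i) :=
          measureReal_mono (fun x hx => Or.inr hx)
        have := h i
        rw [Set.inter_comm] at h1
        linarith
      · refine ht.1.trans (hη _ measureReal_nonneg (lt_of_le_of_lt ?_ (h i)))
        refine measureReal_mono ?_ (measure_ne_top _ _)
        intro x hx
        exact Or.inl ⟨hx.1, fun hxi => Set.disjoint_left.1 (hB.2.1 hij) hxi hx.2⟩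
  unfold condEntropy'
  have : ∀ j ∈ (Finset.univ : Finset (Fin r)), (μ (B j)).toReal *
      ∑ i, Real.negMulLog (condProb μ (A i) (B j)) ≤ r * η := by
    intro j _
    rw [Finset.mul_sum]
    refine (Finset.sum_le_card_nsmul _ _ η (fun i _ => key j i)).trans ?_
    simp
  refine (Finset.sum_le_card_nsmul _ _ _ this).trans ?_
  simp

/-- If every sequence in `K ⊆ 𝔓_r` has bounded mean complexity, then the
set of indicator functions of atoms of partitions in `K` is precompact in `L²(μ)`;
consequently `K` is precompact in the Rokhlin metric. -/
theorem precompact_of_sequences_boundedMeanComplexity (μ : Measure X) [IsProbabilityMeasure μ]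
    {r : ℕ} (hr : 2 ≤ r) [DecidableEq (Fin r → Set X)]
    (K : Set (Fin r → Set X)) (hK : ∀ α ∈ K, IsPartition μ α)
    (hbd : ∀ A : ℕ → Fin r → Set X, (∀ n, A n ∈ K) →
      ∀ ε > (0 : ℝ), ∃ C : ℕ, ∀ n : ℕ,
        ∃ D : Finset X, D.card ≤ C ∧
          μ (⋃ x ∈ D, hamBall ((Finset.range n).image A) x ε) > 1 - ENNReal.ofReal ε) :
    TotallyBounded {f : Lp ℝ 2 μ | ∃ α, ∃ hα : α ∈ K, ∃ i : Fin r,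
      f = indicatorConstLp 2 ((hK α hα).1 i) (measure_ne_top μ (α i)) (1 : ℝ)} ∧
    TotBddIn (rokhlinDist μ) K := by
  have hT := pc_totBdd μ K hK hbd
  constructor
  · rw [Metric.totallyBounded_iff]
    intro ε hε
    obtain ⟨F, hFK, hF⟩ := hT (ε ^ 2) (by positivity)
    refine ⟨{f : Lp ℝ 2 μ | ∃ α, ∃ hα : α ∈ F, ∃ i : Fin r,
      f = indicatorConstLp 2 ((hK α (hFK hα)).1 i) (measure_ne_top μ (α i)) (1 : ℝ)}, ?_, ?_⟩
    · refine (Set.finite_range (fun p : F × Fin r => (indicatorConstLp 2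
        ((hK p.1.1 (hFK p.1.2)).1 p.2) (measure_ne_top μ (p.1.1 p.2)) (1 : ℝ) :
          Lp ℝ 2 μ))).subset ?_
      rintro f ⟨α, hα, i, rfl⟩
      exact ⟨(⟨α, hα⟩, i), rfl⟩
    · rintro f ⟨α, hα, i, rfl⟩
      obtain ⟨β, hβ, h⟩ := hF α hα
      simp only [Set.mem_iUnion]
      refine ⟨_, ⟨β, hβ, i, rfl⟩, ?_⟩
      rw [Metric.mem_ball, dist_indicatorConstLp_eq_norm, norm_indicatorConstLp (by simp) (by simp)]
      have h1 := h i
      have h2 : μ.real (α i ∆ β i) ^ (1 / (2 : ℝ≥0∞).toReal) < (ε ^ 2) ^ (1 / (2 : ℝ≥0∞).toReal) :=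
        Real.rpow_lt_rpow measureReal_nonneg h1 (by simp)
      have h3 : (ε ^ 2) ^ (1 / (2 : ℝ≥0∞).toReal) = ε := by
        rw [ENNReal.toReal_ofNat, ← Real.sqrt_eq_rpow, Real.sqrt_sq hε.le]
      rw [h3] at h2
      simpa using h2
  · intro ε hε
    have hr0 : (0 : ℝ) < r := by
      have : 0 < r := by omega
      exact_mod_cast this
    set η : ℝ := ε / (4 * (r * r)) with hηdef
    have hη : 0 < η := by positivity
    have hcont := Metric.continuousAt_iff.1 (Real.continuous_negMulLog.continuousAt (x := 0)) η hη
    obtain ⟨δ, hδ, hc⟩ := hcont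
    have hmin : 0 < min δ η := lt_min hδ hη
    have hsmall : ∀ p, 0 ≤ p → p < min δ η → Real.negMulLog p ≤ η := by
      intro p hp hpd
      have := hc (x := p) (by
        rw [Real.dist_eq, sub_zero, abs_of_nonneg hp]
        exact hpd.trans_le (min_le_left _ _))
      rw [Real.dist_eq, Real.negMulLog_zero, sub_zero] at this
      exact (le_abs_self _).trans this.le
    obtain ⟨F, hFK, hF⟩ := hT (min δ η) hmin
    refine ⟨F, hFK, fun a ha => ?_⟩
    obtain ⟨b, hb, h⟩ := hF a ha
    refine ⟨b, hb, ?_⟩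
    have h1 := pc_entropy μ a b (hK a ha) (hK b (hFK hb)) _ η (min_le_right _ _) hsmall hmin h
    have h2 := pc_entropy μ b a (hK b (hFK hb)) (hK a ha) _ η (min_le_right _ _) hsmall hmin
      (fun i => by rw [symmDiff_comm]; exact h i)
    have h3 : (r : ℝ) * (r * η) = ε / 4 := by
      rw [hηdef]
      field_simp
    unfold rokhlinDist
    linarith
end

section
/- For a measure-preserving system (X,ℬ,μ,G) and S ⊂ G, the collection 𝒦 of measurable sets A with h*_{μ,S}({A, Aᶜ}) = 0 is a sub-σ-algebra of ℬ; moreover if S = G then 𝒦 is G-invariant. -/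
open MeasureTheory Filter Real Topology
open scoped symmDiff ENNReal

variable {X : Type*} [MeasurableSpace X]

/-- `P*` along `S`: `sup` of joint entropies `H_μ(⋁_{i<n} g_i⁻¹ α)` over `n`-tuples from `S`. -/
noncomputable def patternSupS (μ : Measure X) {G : Type*} [Group G] [MulAction G X]
    (S : Set G) {ι : Type*} [Fintype ι] (A : ι → Set X) (n : ℕ) : ℝ :=
  sSup {H : ℝ | ∃ g : Fin n → G, (∀ i, g i ∈ S) ∧
    H = jointEntropy μ (fun i => fun j => (fun x => g i • x) ⁻¹' A j)}

/-- The maximal pattern entropy of the partition `A` along `S ⊆ G`. -/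
noncomputable def hStarS (μ : Measure X) {G : Type*} [Group G] [MulAction G X]
    (S : Set G) {ι : Type*} [Fintype ι] (A : ι → Set X) : ℝ :=
  limsup (fun n => patternSupS μ S A n / n) atTop

/-- The two-set partition `{A, Aᶜ}`. -/
def twoPart (A : Set X) : Bool → Set X := fun b => if b then A else Aᶜ

/-- The collection `𝒦` of measurable sets whose two-set partition has zero maximal
pattern entropy along `S`. -/
def zeroHStarSets (μ : Measure X) {G : Type*} [Group G] [MulAction G X] (S : Set G) :
    Set (Set X) :=
  {A | MeasurableSet A ∧ hStarS μ S (twoPart A) = 0}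

/-- Entropy of a finite-valued map. -/
noncomputable def mapEnt (μ : Measure X) {α : Type*} [Fintype α] (F : X → α) : ℝ :=
  ∑ a, Real.negMulLog (μ.real (F ⁻¹' {a}))

lemma negMulLog_sum_le {α : Type*} (s : Finset α) (p : α → ℝ) (hp : ∀ a, 0 ≤ p a) :
    Real.negMulLog (∑ a ∈ s, p a) ≤ ∑ a ∈ s, Real.negMulLog (p a) := by
  simp only [Real.negMulLog, neg_mul, Finset.sum_neg_distrib, neg_le_neg_iff]
  rw [Finset.sum_mul]
  refine Finset.sum_le_sum fun a ha => ?_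
  rcases (hp a).eq_or_lt with h | h
  · simp [← h]
  · exact mul_le_mul_of_nonneg_left
      (Real.log_le_log h (Finset.single_le_sum (fun b _ => hp b) ha)) h.le

lemma negMulLog_gibbs (p q : ℝ) (hp : 0 ≤ p) (hq : 0 < q) :
    Real.negMulLog p ≤ -(p * Real.log q) + q - p := by
  rcases hp.eq_or_lt with h | h
  · simp [← h, hq.le]
  · have h1 := Real.log_le_sub_one_of_pos (div_pos hq h)
    rw [Real.log_div hq.ne' h.ne'] at h1
    have h2 := mul_le_mul_of_nonneg_left h1 hp
    have h3 : p * (q / p - 1) = q - p := by field_simp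
    rw [h3] at h2
    simp only [Real.negMulLog]
    linarith

lemma sum_negMulLog_prod_le {α β : Type*} [Fintype α] [Fintype β] (p : α → β → ℝ)
    (hp : ∀ a b, 0 ≤ p a b) (h1 : ∑ a, ∑ b, p a b = 1) :
    ∑ a, ∑ b, Real.negMulLog (p a b) ≤
      ∑ a, Real.negMulLog (∑ b, p a b) + ∑ b, Real.negMulLog (∑ a, p a b) := by
  set u : α → ℝ := fun a => ∑ b, p a b with hu
  set v : β → ℝ := fun b => ∑ a, p a b with hv
  have hpu : ∀ a b, p a b ≤ u a := fun a b =>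
    Finset.single_le_sum (f := fun b => p a b) (fun b _ => hp a b) (Finset.mem_univ b)
  have hpv : ∀ a b, p a b ≤ v b := fun a b =>
    Finset.single_le_sum (f := fun a => p a b) (fun a _ => hp a b) (Finset.mem_univ a)
  have key : ∀ a b, Real.negMulLog (p a b) ≤
      -(p a b * Real.log (u a)) - p a b * Real.log (v b) + u a * v b - p a b := by
    intro a b
    rcases (hp a b).eq_or_lt with h | h
    · have : 0 ≤ u a * v b := mul_nonneg ((hp a b).trans (hpu a b)) ((hp a b).trans (hpv a b))
      simp [← h, this]
    · have hua := h.trans_le (hpu a b)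
      have hvb := h.trans_le (hpv a b)
      have := negMulLog_gibbs (p a b) (u a * v b) h.le (mul_pos hua hvb)
      rw [Real.log_mul hua.ne' hvb.ne'] at this
      linarith
  have hv1 : ∑ b, v b = 1 := by rw [hv, Finset.sum_comm]; exact h1
  have hsum := Finset.sum_le_sum fun a (_ : a ∈ Finset.univ) =>
    Finset.sum_le_sum fun b (_ : b ∈ Finset.univ) => key a b
  refine hsum.trans (le_of_eq ?_)
  simp only [Finset.sum_sub_distrib, Finset.sum_add_distrib, Finset.sum_neg_distrib]
  have e1 : ∑ a, ∑ b, u a * v b = 1 := by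
    simp only [← Finset.mul_sum, hv1, mul_one]; exact h1
  have e2 : ∑ a, ∑ b, p a b * Real.log (u a) = ∑ a, u a * Real.log (u a) := by
    simp only [← Finset.sum_mul, hu]
  have e3 : ∑ a, ∑ b, p a b * Real.log (v b) = ∑ b, v b * Real.log (v b) := by
    rw [Finset.sum_comm]
    simp only [← Finset.sum_mul, hv]
  rw [e1, e2, e3, h1]
  simp only [Real.negMulLog, neg_mul, Finset.sum_neg_distrib]
  ring

lemma mapEnt_comp_le (μ : Measure X) [IsProbabilityMeasure μ] {α β : Type*} [Fintype α]
    [Fintype β] [MeasurableSpace α] [MeasurableSingletonClass α]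
    (F : X → α) (hF : Measurable F) (φ : α → β) :
    mapEnt μ (fun x => φ (F x)) ≤ mapEnt μ F := by
  classical
  unfold mapEnt
  rw [← Finset.sum_fiberwise Finset.univ φ (fun a => Real.negMulLog (μ.real (F ⁻¹' {a})))]
  refine Finset.sum_le_sum fun b _ => ?_
  have : μ.real ((fun x => φ (F x)) ⁻¹' {b})
      = ∑ a ∈ Finset.univ.filter (fun a => φ a = b), μ.real (F ⁻¹' {a}) := by
    rw [sum_measureReal_preimage_singleton _ (fun a _ => hF (measurableSet_singleton a))]
    congr 1
    ext x
    simp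
  rw [this]
  exact negMulLog_sum_le _ _ fun a => measureReal_nonneg

lemma mapEnt_pair_le (μ : Measure X) [IsProbabilityMeasure μ] {α β : Type*} [Fintype α]
    [Fintype β] [MeasurableSpace α] [MeasurableSingletonClass α]
    [MeasurableSpace β] [MeasurableSingletonClass β]
    (F : X → α) (hF : Measurable F) (F' : X → β) (hF' : Measurable F') :
    mapEnt μ (fun x => (F x, F' x)) ≤ mapEnt μ F + mapEnt μ F' := by
  classical
  have hP : Measurable fun x => (F x, F' x) := hF.prodMk hF'
  set p : α → β → ℝ := fun a b => μ.real ((fun x => (F x, F' x)) ⁻¹' {(a, b)}) with hp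
  have ha : ∀ a, μ.real (F ⁻¹' {a}) = ∑ b, p a b := by
    intro a
    have h := sum_measureReal_preimage_singleton (μ := μ) (({a} : Finset α) ×ˢ (Finset.univ : Finset β))
      (f := fun x => (F x, F' x)) (fun y _ => hP (measurableSet_singleton y))
    rw [Finset.sum_product, Finset.sum_singleton] at h
    rw [hp, h]
    congr 1
    ext x
    simp [eq_comm]
  have hb : ∀ b, μ.real (F' ⁻¹' {b}) = ∑ a, p a b := by
    intro b
    have h := sum_measureReal_preimage_singleton (μ := μ) ((Finset.univ : Finset α) ×ˢ ({b} : Finset β))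
      (f := fun x => (F x, F' x)) (fun y _ => hP (measurableSet_singleton y))
    simp only [Finset.sum_product, Finset.sum_singleton] at h
    rw [hp, h]
    congr 1
    ext x
    simp [eq_comm]
  have h1 : ∑ a, ∑ b, p a b = 1 := by
    simp only [← ha]
    rw [sum_measureReal_preimage_singleton _ (fun a _ => hF (measurableSet_singleton a))]
    simp
  have := sum_negMulLog_prod_le p (fun a b => measureReal_nonneg) h1
  unfold mapEnt
  rw [Fintype.sum_prod_type]
  simp only [ha, hb]
  exact this

lemma mapEnt_tuple_le (μ : Measure X) [IsProbabilityMeasure μ] :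
    ∀ (n : ℕ) (F : X → Fin n → Bool), Measurable F →
      mapEnt μ F ≤ ∑ i, mapEnt μ (fun x => F x i) := by
  intro n
  induction n with
  | zero =>
    intro F _
    have : ∀ a : Fin 0 → Bool, F ⁻¹' {a} = Set.univ := by
      intro a; ext x; simp [eq_iff_true_of_subsingleton]
    simp [mapEnt, this]
  | succ n ih =>
    intro F hF
    have h0 : Measurable fun x => F x 0 := (measurable_pi_apply 0).comp hF
    have ht : Measurable fun x => Fin.tail (F x) :=
      measurable_pi_lambda _ fun i => (measurable_pi_apply i.succ).comp hF
    have h1 := mapEnt_comp_le μ (fun x => (F x 0, Fin.tail (F x))) (h0.prodMk ht)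
      (fun q : Bool × (Fin n → Bool) => (Fin.cons q.1 q.2 : Fin (n+1) → Bool))
    simp only [Fin.cons_self_tail] at h1
    have h2 := mapEnt_pair_le μ _ h0 _ ht
    have h3 := ih _ ht
    rw [Fin.sum_univ_succ]
    simp only [Fin.tail] at h3 h2 h1
    linarith

open Classical in
/-- The coding map of a set along a tuple. -/
noncomputable def codeMap {G : Type*} [Group G] [MulAction G X] {n : ℕ} (g : Fin n → G)
    (A : Set X) : X → Fin n → Bool := fun x i => decide (g i • x ∈ A)

lemma measurable_codeMap {μ : Measure X} {G : Type*} [Group G] [MulAction G X]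
    (hmp : ∀ g : G, MeasurePreserving (fun x => g • x) μ μ) {n : ℕ} (g : Fin n → G)
    {A : Set X} (hA : MeasurableSet A) : Measurable (codeMap g A) := by
  classical
  refine measurable_pi_lambda _ fun i => measurable_to_bool ?_
  have : (fun x => codeMap g A x i) ⁻¹' {true} = (fun x => g i • x) ⁻¹' A := by
    ext x; simp [codeMap]
  rw [this]
  exact (hmp (g i)).measurable hA

/-- The joint entropy along a tuple. -/
noncomputable def jEnt (μ : Measure X) {G : Type*} [Group G] [MulAction G X] {n : ℕ}
    (g : Fin n → G) (A : Set X) : ℝ :=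
  jointEntropy μ (fun i => fun j => (fun x => g i • x) ⁻¹' twoPart A j)

lemma jEnt_eq (μ : Measure X) {G : Type*} [Group G] [MulAction G X] {n : ℕ}
    (g : Fin n → G) (A : Set X) : jEnt μ g A = mapEnt μ (codeMap g A) := by
  classical
  unfold jEnt jointEntropy mapEnt
  refine Finset.sum_congr rfl fun f _ => ?_
  rw [measureReal_def]
  congr 3
  ext x
  simp only [Set.mem_iInter, Set.mem_preimage, Set.mem_singleton_iff, funext_iff]
  refine forall_congr' fun i => ?_
  cases h : f i <;> simp [twoPart, codeMap]

lemma jEnt_nonneg (μ : Measure X) [IsProbabilityMeasure μ] {G : Type*} [Group G]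
    [MulAction G X] {n : ℕ} (g : Fin n → G) (A : Set X) : 0 ≤ jEnt μ g A := by
  rw [jEnt_eq]
  exact Finset.sum_nonneg fun a _ => Real.negMulLog_nonneg measureReal_nonneg measureReal_le_one

lemma jEnt_le_bin {μ : Measure X} [IsProbabilityMeasure μ] {G : Type*} [Group G]
    [MulAction G X] (hmp : ∀ g : G, MeasurePreserving (fun x => g • x) μ μ)
    {n : ℕ} (g : Fin n → G) {A : Set X} (hA : MeasurableSet A) :
    jEnt μ g A ≤ n * Real.binEntropy (μ.real A) := by
  classical
  rw [jEnt_eq]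
  refine (mapEnt_tuple_le μ n _ (measurable_codeMap hmp g hA)).trans (le_of_eq ?_)
  have : ∀ i, mapEnt μ (fun x => codeMap g A x i) = Real.binEntropy (μ.real A) := by
    intro i
    have e1 : (fun x => codeMap g A x i) ⁻¹' {true} = (fun x => g i • x) ⁻¹' A := by
      ext x; simp [codeMap]
    have e2 : (fun x => codeMap g A x i) ⁻¹' {false} = (fun x => g i • x) ⁻¹' Aᶜ := by
      ext x; simp [codeMap]
    rw [mapEnt, Fintype.sum_bool, e1, e2, (hmp (g i)).measureReal_preimage hA.nullMeasurableSet,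
      (hmp (g i)).measureReal_preimage hA.compl.nullMeasurableSet,
      probReal_compl_eq_one_sub hA, Real.binEntropy_eq_negMulLog_add_negMulLog_one_sub]
  simp [this]

lemma jEnt_union_le {μ : Measure X} [IsProbabilityMeasure μ] {G : Type*} [Group G]
    [MulAction G X] (hmp : ∀ g : G, MeasurePreserving (fun x => g • x) μ μ)
    {n : ℕ} (g : Fin n → G) {A B : Set X} (hA : MeasurableSet A) (hB : MeasurableSet B) :
    jEnt μ g (A ∪ B) ≤ jEnt μ g A + jEnt μ g B := by
  classical
  simp only [jEnt_eq]
  have mA := measurable_codeMap hmp g hA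
  have mB := measurable_codeMap hmp g hB
  have h1 := mapEnt_comp_le μ (fun x => (codeMap g A x, codeMap g B x)) (mA.prodMk mB)
    (fun q => fun i => (q.1 i || q.2 i))
  have e : codeMap g (A ∪ B) = fun x => fun i => (codeMap g A x i || codeMap g B x i) := by
    funext x i
    simp [codeMap]
  rw [e]
  exact h1.trans (mapEnt_pair_le μ _ mA _ mB)

lemma jEnt_compl_le {μ : Measure X} [IsProbabilityMeasure μ] {G : Type*} [Group G]
    [MulAction G X] (hmp : ∀ g : G, MeasurePreserving (fun x => g • x) μ μ)
    {n : ℕ} (g : Fin n → G) {A : Set X} (hA : MeasurableSet A) :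
    jEnt μ g Aᶜ ≤ jEnt μ g A := by
  classical
  simp only [jEnt_eq]
  have h1 := mapEnt_comp_le μ _ (measurable_codeMap hmp g hA) (fun q => fun i => !(q i))
  have e : codeMap g Aᶜ = fun x => fun i => !(codeMap g A x i) := by
    funext x i
    simp [codeMap]
  rw [e]
  exact h1

lemma hStarS_eq_zero_iff {μ : Measure X} [IsProbabilityMeasure μ] {G : Type*} [Group G]
    [MulAction G X] (hmp : ∀ g : G, MeasurePreserving (fun x => g • x) μ μ) (S : Set G)
    {A : Set X} (hA : MeasurableSet A) :
    hStarS μ S (twoPart A) = 0 ↔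
      ∀ ε > 0, ∀ᶠ n : ℕ in atTop, ∀ g : Fin n → G, (∀ i, g i ∈ S) → jEnt μ g A ≤ n * ε := by
  have hnn : ∀ n, 0 ≤ patternSupS μ S (twoPart A) n := by
    intro n
    refine Real.sSup_nonneg ?_
    rintro _ ⟨g, _, rfl⟩
    exact jEnt_nonneg μ g A
  have hle : ∀ n, ∀ c : ℝ, 0 ≤ c → (∀ g : Fin n → G, (∀ i, g i ∈ S) → jEnt μ g A ≤ n * c) →
      patternSupS μ S (twoPart A) n / n ≤ c := by
    intro n c hc h
    have : patternSupS μ S (twoPart A) n ≤ n * c := by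
      refine Real.sSup_le ?_ (by positivity)
      rintro _ ⟨g, hg, rfl⟩
      exact h g hg
    rcases n.eq_zero_or_pos with h0 | h0
    · simp [h0, hc]
    · rw [div_le_iff₀ (by exact_mod_cast h0)]
      linarith
  have hub : ∀ n : ℕ, patternSupS μ S (twoPart A) n / n ≤ Real.log 2 := by
    intro n
    refine hle n _ (Real.log_nonneg (by norm_num)) fun g _ => ?_
    exact (jEnt_le_bin hmp g hA).trans
      (mul_le_mul_of_nonneg_left Real.binEntropy_le_log_two n.cast_nonneg)
  have hlb : ∀ n : ℕ, 0 ≤ patternSupS μ S (twoPart A) n / n := fun n =>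
    div_nonneg (hnn n) n.cast_nonneg
  have hB : IsBoundedUnder (· ≤ ·) atTop (fun n : ℕ => patternSupS μ S (twoPart A) n / n) :=
    isBoundedUnder_of ⟨_, hub⟩
  have hC : IsCoboundedUnder (· ≤ ·) atTop (fun n : ℕ => patternSupS μ S (twoPart A) n / n) :=
    (isBoundedUnder_of (r := (· ≥ ·)) ⟨0, hlb⟩).isCoboundedUnder_le
  constructor
  · intro h ε hε
    have h1 := eventually_lt_of_limsup_lt (f := atTop)
      (u := fun n : ℕ => patternSupS μ S (twoPart A) n / n) (b := ε)
      (by change hStarS μ S (twoPart A) < ε; rw [h]; exact hε) hB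
    filter_upwards [h1, eventually_gt_atTop 0] with n hn h0 g hg
    rw [div_lt_iff₀ (by exact_mod_cast h0)] at hn
    have h2 : jEnt μ g A ≤ patternSupS μ S (twoPart A) n := by
      refine le_csSup ⟨n * Real.binEntropy (μ.real A), ?_⟩ ⟨g, hg, rfl⟩
      rintro _ ⟨g', _, rfl⟩
      exact jEnt_le_bin hmp g' hA
    linarith
  · intro h
    refine le_antisymm (le_of_forall_pos_le_add fun ε hε => ?_) ?_
    · rw [zero_add]
      refine limsup_le_of_le hC ?_
      filter_upwards [h ε hε] with n hn
      exact hle n ε hε.le hn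
    · exact le_limsup_of_frequently_le (Frequently.of_forall hlb) hB

lemma zeroHStar_union {μ : Measure X} [IsProbabilityMeasure μ] {G : Type*} [Group G]
    [MulAction G X] (hmp : ∀ g : G, MeasurePreserving (fun x => g • x) μ μ) (S : Set G)
    {A B : Set X} (hA : A ∈ zeroHStarSets μ S) (hB : B ∈ zeroHStarSets μ S) :
    A ∪ B ∈ zeroHStarSets μ S := by
  refine ⟨hA.1.union hB.1, (hStarS_eq_zero_iff hmp S (hA.1.union hB.1)).2 fun ε hε => ?_⟩
  filter_upwards [(hStarS_eq_zero_iff hmp S hA.1).1 hA.2 (ε / 2) (half_pos hε),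
    (hStarS_eq_zero_iff hmp S hB.1).1 hB.2 (ε / 2) (half_pos hε)] with n h1 h2 g hg
  have := jEnt_union_le hmp g hA.1 hB.1
  have := h1 g hg
  have := h2 g hg
  linarith

lemma zeroHStar_empty {μ : Measure X} [IsProbabilityMeasure μ] {G : Type*} [Group G]
    [MulAction G X] (hmp : ∀ g : G, MeasurePreserving (fun x => g • x) μ μ) (S : Set G) :
    (∅ : Set X) ∈ zeroHStarSets μ S := by
  refine ⟨.empty, (hStarS_eq_zero_iff hmp S .empty).2 fun ε hε => .of_forall fun n g _ => ?_⟩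
  refine (jEnt_le_bin hmp g .empty).trans ?_
  simp only [measureReal_empty, Real.binEntropy_zero, mul_zero]
  positivity

lemma zeroHStar_compl {μ : Measure X} [IsProbabilityMeasure μ] {G : Type*} [Group G]
    [MulAction G X] (hmp : ∀ g : G, MeasurePreserving (fun x => g • x) μ μ) (S : Set G)
    {A : Set X} (hA : A ∈ zeroHStarSets μ S) : Aᶜ ∈ zeroHStarSets μ S := by
  refine ⟨hA.1.compl, (hStarS_eq_zero_iff hmp S hA.1.compl).2 fun ε hε => ?_⟩
  filter_upwards [(hStarS_eq_zero_iff hmp S hA.1).1 hA.2 ε hε] with n h1 g hg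
  exact (jEnt_compl_le hmp g hA.1).trans (h1 g hg)

lemma zeroHStar_iUnion {μ : Measure X} [IsProbabilityMeasure μ] {G : Type*} [Group G]
    [MulAction G X] (hmp : ∀ g : G, MeasurePreserving (fun x => g • x) μ μ) (S : Set G)
    (f : ℕ → Set X) (hf : ∀ k, f k ∈ zeroHStarSets μ S) :
    (⋃ k, f k) ∈ zeroHStarSets μ S := by
  have hacc : ∀ k, Set.accumulate f k ∈ zeroHStarSets μ S := by
    intro k
    induction k with
    | zero => simpa using hf 0
    | succ k ih =>
      rw [Set.accumulate_succ]
      exact zeroHStar_union hmp S ih (hf _)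
  have hU : MeasurableSet (⋃ k, f k) := .iUnion fun k => (hf k).1
  refine ⟨hU, (hStarS_eq_zero_iff hmp S hU).2 fun ε hε => ?_⟩
  have hsub : ∀ k, Set.accumulate f k ⊆ ⋃ k, f k := fun k => Set.accumulate_subset_iUnion k
  have t1 : Tendsto (fun k => μ.real ((⋃ k, f k) \ Set.accumulate f k)) atTop (𝓝 0) := by
    have h := tendsto_measure_iUnion_accumulate (μ := μ) (f := f)
    have h' := (ENNReal.tendsto_toReal (measure_ne_top μ (⋃ k, f k))).comp h
    have h2 : Tendsto (fun k => μ.real (⋃ k, f k) - μ.real (Set.accumulate f k)) atTop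
        (𝓝 (μ.real (⋃ k, f k) - μ.real (⋃ k, f k))) := tendsto_const_nhds.sub h'
    rw [sub_self] at h2
    refine h2.congr fun k => ?_
    rw [measureReal_sdiff (hsub k) (hacc k).1]
  have t2 := (Real.binEntropy_continuous.tendsto 0).comp t1
  rw [Real.binEntropy_zero] at t2
  obtain ⟨k, hk⟩ := (t2.eventually_lt_const (half_pos hε)).exists
  simp only [Function.comp] at hk
  filter_upwards [(hStarS_eq_zero_iff hmp S (hacc k).1).1 (hacc k).2 (ε / 2) (half_pos hε)]
    with n h1 g hg
  have hD : MeasurableSet ((⋃ k, f k) \ Set.accumulate f k) := hU.diff (hacc k).1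
  have h2 := jEnt_union_le hmp g (hacc k).1 hD
  rw [Set.union_sdiff_cancel (hsub k)] at h2
  have h3 := jEnt_le_bin hmp g hD
  have h4 := mul_le_mul_of_nonneg_left hk.le (Nat.cast_nonneg (α := ℝ) n)
  have := h1 g hg
  linarith

/-- The collection `𝒦` of measurable sets `A` with
`h*_{μ,S}({A,Aᶜ}) = 0` is a sub-σ-algebra of `ℬ` (i.e. it consists of measurable sets and
coincides with the σ-algebra it generates); moreover if `S = G` then `𝒦` is `G`-invariant. -/
theorem zero_hStar_sets_sigmaAlgebra (μ : Measure X) [IsProbabilityMeasure μ]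
    {G : Type*} [Group G] [MulAction G X]
    (hmp : ∀ g : G, MeasurePreserving (fun x => g • x) μ μ) (S : Set G) :
    (∀ A : Set X,
      MeasurableSet[MeasurableSpace.generateFrom (zeroHStarSets μ S)] A ↔
        A ∈ zeroHStarSets μ S) ∧
    (S = Set.univ → ∀ (g : G) (A : Set X),
      A ∈ zeroHStarSets μ S → (fun x => g • x) ⁻¹' A ∈ zeroHStarSets μ S) := by
  refine ⟨fun A => ⟨fun h => ?_, fun h => MeasurableSpace.measurableSet_generateFrom h⟩, ?_⟩
  · induction A, h using MeasurableSpace.generateFrom_induction with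
    | hC A hA _ => exact hA
    | empty => exact zeroHStar_empty hmp S
    | compl A _ ih => exact zeroHStar_compl hmp S ih
    | iUnion f _ ih => exact zeroHStar_iUnion hmp S f ih
  · rintro rfl g A hA
    have hm : MeasurableSet ((fun x => g • x) ⁻¹' A) := (hmp g).measurable hA.1
    refine ⟨hm, (hStarS_eq_zero_iff hmp _ hm).2 fun ε hε => ?_⟩
    filter_upwards [(hStarS_eq_zero_iff hmp _ hA.1).1 hA.2 ε hε] with n h1 k _
    have h2 := h1 (fun i => g * k i) (fun i => Set.mem_univ _)
    rw [jEnt_eq] at h2 ⊢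
    have e : codeMap k ((fun x => g • x) ⁻¹' A) = codeMap (fun i => g * k i) A := by
      funext x i
      simp [codeMap, mul_smul]
    rwa [e]
end
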